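/- Let x̄ be a weak local minimizer of problem (P), and let F(x) := sup{ λ·(f(x) − f(x̄)) + μ·g(x) : (λ,μ) ∈ Λ }. Then for every direction u ∈ ℝ^s one has d_H F(x̄; u) ≥ 0 and d²_H F(x̄; 0; u) ≥ 0, where d²_H F(x̄;0;u) := liminf_{t↓0, u'→u} 2 t^{-2} [F(x̄ + t u') − F(x̄)] is the second-order lower Hadamard derivative taken with the zero linear functional. -/

import Mathlib

open Filter Topology Pointwise

noncomputable section

/-- Euclidean dot product on `Fin n → ℝ`. -/
def dotp {n : ℕ} (a b : Fin n → ℝ) : ℝ := ∑ i, a i * b i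

/-- Positive polar cone `C* = {l | l·x ≥ 0 for all x ∈ C}`. -/
def polarCone {n : ℕ} (C : Set (Fin n → ℝ)) : Set (Fin n → ℝ) :=
  {l | ∀ x ∈ C, 0 ≤ dotp l x}

/-- A closed convex pointed cone with vertex at the origin. -/
def IsClosedConvexPointedCone {n : ℕ} (C : Set (Fin n → ℝ)) : Prop :=
  IsClosed C ∧ Convex ℝ C ∧ (0 : Fin n → ℝ) ∈ C ∧
    (∀ c : ℝ, 0 ≤ c → ∀ x ∈ C, c • x ∈ C) ∧ C ∩ (-C) ⊆ {0}

/-- The set Λ of normalized multiplier pairs. -/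
def LambdaSet {n m : ℕ} (C : Set (Fin n → ℝ)) (K : Set (Fin m → ℝ)) :
    Set ((Fin n → ℝ) × (Fin m → ℝ)) :=
  {p | p.1 ∈ polarCone C ∧ p.2 ∈ polarCone K ∧
    (∑ i, |p.1 i|) + (∑ j, |p.2 j|) = 1}

/-- `x̄` is a weak local minimizer of problem (P): no feasible point near `x̄`
has `f x ∈ f x̄ − int C`. -/
def WeakLocalMin {s n m : ℕ} (C : Set (Fin n → ℝ)) (K : Set (Fin m → ℝ))
    (X : Set (Fin s → ℝ)) (f : (Fin s → ℝ) → (Fin n → ℝ))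
    (g : (Fin s → ℝ) → (Fin m → ℝ)) (xbar : Fin s → ℝ) : Prop :=
  ∃ N ∈ 𝓝 xbar, ∀ x ∈ N, x ∈ X → g x ∈ -K →
    f x ∉ ({f xbar} : Set (Fin n → ℝ)) - interior C

/-- The auxiliary function `F(x) = sup{λ·(f x − f x̄) + μ·g x : (λ,μ) ∈ Λ}`. -/
def Ffun {s n m : ℕ} (C : Set (Fin n → ℝ)) (K : Set (Fin m → ℝ))
    (f : (Fin s → ℝ) → (Fin n → ℝ)) (g : (Fin s → ℝ) → (Fin m → ℝ))
    (xbar x : Fin s → ℝ) : ℝ :=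
  sSup ((fun p => dotp p.1 (f x - f xbar) + dotp p.2 (g x)) '' LambdaSet C K)

/-- Lower Hadamard directional derivative,
`liminf_{t↓0, u'→u} (F(x + t u') − F(x))/t`, valued in `EReal`. -/
def lowerHadamardDeriv {s : ℕ} (F : (Fin s → ℝ) → ℝ) (x u : Fin s → ℝ) : EReal :=
  liminf (fun p : ℝ × (Fin s → ℝ) =>
      (((F (x + p.1 • p.2) - F x) / p.1 : ℝ) : EReal))
    ((𝓝[>] (0 : ℝ)) ×ˢ 𝓝 u)

/-- Second-order lower Hadamard derivative relative to a linear functional `L`,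
`liminf_{t↓0, u'→u} 2(F(x + t u') − F(x) − t·L(u'))/t²`, valued in `EReal`. -/
def lowerHadamardDeriv2 {s : ℕ} (F : (Fin s → ℝ) → ℝ) (x : Fin s → ℝ)
    (L : (Fin s → ℝ) →L[ℝ] ℝ) (u : Fin s → ℝ) : EReal :=
  liminf (fun p : ℝ × (Fin s → ℝ) =>
      ((2 * (F (x + p.1 • p.2) - F x - p.1 * L p.2) / p.1 ^ 2 : ℝ) : EReal))
    ((𝓝[>] (0 : ℝ)) ×ˢ 𝓝 u)

/-- Every continuous linear functional on `Fin n → ℝ` is a dot product. -/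
theorem exists_dotp_eq {n : ℕ} (l : (Fin n → ℝ) →L[ℝ] ℝ) :
    ∃ v : Fin n → ℝ, ∀ x, dotp v x = l x := by
  refine ⟨fun i => l (Pi.single i 1), fun x => ?_⟩
  have h := LinearMap.pi_apply_eq_sum_univ (l : (Fin n → ℝ) →ₗ[ℝ] ℝ) x
  simp only [ContinuousLinearMap.coe_coe, smul_eq_mul] at h
  rw [h, dotp]
  refine Finset.sum_congr rfl fun i _ => ?_
  rw [mul_comm]
  congr 2
  ext j
  simp [Pi.single_apply, eq_comm]

/-- The dot product is homogeneous in its first argument. -/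
theorem dotp_smul_left {n : ℕ} (c : ℝ) (a b : Fin n → ℝ) :
    dotp (c • a) b = c * dotp a b := by
  simp [dotp, Finset.mul_sum, mul_assoc]

theorem dotp_zero_left {n : ℕ} (b : Fin n → ℝ) : dotp 0 b = 0 := by
  simp [dotp]

theorem dotp_neg_right {n : ℕ} (a b : Fin n → ℝ) : dotp a (-b) = -dotp a b := by
  simp [dotp]

theorem zero_mem_polarCone {n : ℕ} (C : Set (Fin n → ℝ)) : 0 ∈ polarCone C :=
  fun x _ => (dotp_zero_left x).ge

/-- A linear functional bounded below on a cone is nonnegative there. -/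
theorem nonneg_of_bddBelow_on_cone {n : ℕ} {C : Set (Fin n → ℝ)}
    (hC : ∀ c : ℝ, 0 ≤ c → ∀ x ∈ C, c • x ∈ C) (l : (Fin n → ℝ) →L[ℝ] ℝ) (b : ℝ)
    (hb : ∀ x ∈ C, b ≤ l x) : ∀ x ∈ C, 0 ≤ l x := by
  intro x hx
  by_contra! hneg
  have h := hb _ (hC ((|b| + 1) / (-l x)) (div_nonneg (by positivity) (by linarith)) x hx)
  rw [map_smul, smul_eq_mul, div_mul_eq_mul_div, div_neg, mul_div_assoc,
    div_self hneg.ne] at h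
  linarith [neg_abs_le b]

/-- A point outside the interior of a convex cone is weakly separated from the cone
by a nonzero element of the polar cone. -/
theorem exists_polarCone_dotp_nonpos {n : ℕ} {C : Set (Fin n → ℝ)}
    (hC : IsClosedConvexPointedCone C) (hint : (interior C).Nonempty)
    {d : Fin n → ℝ} (hd : d ∉ interior C) :
    ∃ v ∈ polarCone C, v ≠ 0 ∧ dotp v d ≤ 0 := by
  obtain ⟨_, hconv, hzero, hcone, -⟩ := hC
  obtain ⟨l, hl⟩ := geometric_hahn_banach_open_point hconv.interior isOpen_interior hd
  have hbound : ∀ x ∈ C, l x ≤ l d := by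
    intro x hx
    have hcl : x ∈ closure (interior C) := by
      rw [hconv.closure_interior_eq_closure_of_nonempty_interior hint]
      exact subset_closure hx
    exact closure_minimal (fun a ha => (hl a ha).le)
      (isClosed_le l.continuous continuous_const) hcl
  obtain ⟨v, hv⟩ := exists_dotp_eq (-l)
  refine ⟨v, fun x hx => ?_, ?_, ?_⟩
  · rw [hv]
    exact nonneg_of_bddBelow_on_cone hcone (-l) (-l d)
      (fun y hy => neg_le_neg (hbound y hy)) x hx
  · rintro rfl
    obtain ⟨a, ha⟩ := hint
    have ha' := hl a ha
    have h₁ := hv a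
    have h₂ := hv d
    rw [dotp_zero_left, neg_apply] at h₁ h₂
    linarith
  · have h := hbound 0 hzero
    rw [map_zero] at h
    rw [hv, neg_apply]
    linarith

/-- A point outside a closed convex cone is strictly separated from it by an element
of the polar cone. -/
theorem exists_polarCone_dotp_neg {n : ℕ} {K : Set (Fin n → ℝ)}
    (hK : IsClosedConvexPointedCone K) {y : Fin n → ℝ} (hy : y ∉ K) :
    ∃ v ∈ polarCone K, dotp v y < 0 := by
  obtain ⟨hclosed, hconv, hzero, hcone, -⟩ := hK
  obtain ⟨l, b, hly, hb⟩ := geometric_hahn_banach_point_closed hconv hclosed hy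
  obtain ⟨v, hv⟩ := exists_dotp_eq l
  refine ⟨v, fun x hx => ?_, ?_⟩
  · rw [hv]
    exact nonneg_of_bddBelow_on_cone hcone l b (fun z hz => (hb z hz).le) x hx
  · have h := hb 0 hzero
    rw [map_zero] at h
    rw [hv]
    linarith

/-- Nonnegative multiples of elements of a polar cone stay in the polar cone. -/
theorem smul_mem_polarCone {n : ℕ} {C : Set (Fin n → ℝ)} {v : Fin n → ℝ}
    (hv : v ∈ polarCone C) {c : ℝ} (hc : 0 ≤ c) : c • v ∈ polarCone C := fun x hx => by
  rw [dotp_smul_left]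
  exact mul_nonneg hc (hv x hx)

theorem sum_abs_pos {n : ℕ} {v : Fin n → ℝ} (hv : v ≠ 0) : 0 < ∑ i, |v i| := by
  obtain ⟨i, hi⟩ := Function.ne_iff.mp hv
  exact Finset.sum_pos' (fun j _ => abs_nonneg _) ⟨i, Finset.mem_univ i, abs_pos.mpr hi⟩

/-- Normalizing a vector in the `ℓ¹` norm. -/
theorem sum_abs_inv_smul {n : ℕ} {v : Fin n → ℝ} (hv : v ≠ 0) :
    ∑ i, |((∑ j, |v j|)⁻¹ • v) i| = 1 := by
  have hpos := sum_abs_pos hv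
  simp only [Pi.smul_apply, smul_eq_mul, abs_mul, ← Finset.mul_sum,
    abs_of_pos (inv_pos.mpr hpos)]
  exact inv_mul_cancel₀ hpos.ne'

theorem abs_dotp_le {n : ℕ} (a b : Fin n → ℝ) :
    |dotp a b| ≤ (∑ i, |a i|) * ∑ i, |b i| := by
  refine (Finset.abs_sum_le_sum_abs _ _).trans ?_
  rw [Finset.sum_mul]
  refine Finset.sum_le_sum fun i hi => ?_
  rw [abs_mul]
  exact mul_le_mul_of_nonneg_left
    (Finset.single_le_sum (f := fun j => |b j|) (fun j _ => abs_nonneg _) hi) (abs_nonneg _)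

theorem bddAbove_image_LambdaSet {n m : ℕ} (C : Set (Fin n → ℝ)) (K : Set (Fin m → ℝ))
    (a : Fin n → ℝ) (b : Fin m → ℝ) :
    BddAbove ((fun p => dotp p.1 a + dotp p.2 b) '' LambdaSet C K) := by
  refine ⟨(∑ i, |a i|) + ∑ j, |b j|, ?_⟩
  rintro _ ⟨p, ⟨-, -, hp⟩, rfl⟩
  have h₁ := (le_abs_self _).trans (abs_dotp_le p.1 a)
  have h₂ := (le_abs_self _).trans (abs_dotp_le p.2 b)
  have hp₁ : 0 ≤ ∑ i, |p.1 i| := Finset.sum_nonneg fun _ _ => abs_nonneg _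
  have hp₂ : 0 ≤ ∑ j, |p.2 j| := Finset.sum_nonneg fun _ _ => abs_nonneg _
  have ha : 0 ≤ ∑ i, |a i| := Finset.sum_nonneg fun _ _ => abs_nonneg _
  have hb : 0 ≤ ∑ j, |b j| := Finset.sum_nonneg fun _ _ => abs_nonneg _
  dsimp only
  nlinarith

/-- The auxiliary function is nonnegative at a point that is not a feasible improvement. -/
theorem Ffun_nonneg {s n m : ℕ} {C : Set (Fin n → ℝ)} {K : Set (Fin m → ℝ)}
    (hC : IsClosedConvexPointedCone C) (hK : IsClosedConvexPointedCone K)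
    (hCint : (interior C).Nonempty)
    {f : (Fin s → ℝ) → (Fin n → ℝ)} {g : (Fin s → ℝ) → (Fin m → ℝ)} {xbar x : Fin s → ℝ}
    (hx : g x ∈ -K → f x ∉ ({f xbar} : Set (Fin n → ℝ)) - interior C) :
    0 ≤ Ffun C K f g xbar x := by
  suffices ∃ p ∈ LambdaSet C K, 0 ≤ dotp p.1 (f x - f xbar) + dotp p.2 (g x) by
    obtain ⟨p, hp, h⟩ := this
    exact h.trans (le_csSup (bddAbove_image_LambdaSet C K _ _) ⟨p, hp, rfl⟩)
  by_cases hg : g x ∈ -K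
  · have hd : f xbar - f x ∉ interior C := fun h =>
      hx hg (Set.mem_sub.mpr ⟨f xbar, rfl, f xbar - f x, h, sub_sub_cancel _ _⟩)
    obtain ⟨v, hv, hv0, hvd⟩ := exists_polarCone_dotp_nonpos hC hCint hd
    have hpos := inv_pos.mpr (sum_abs_pos hv0)
    refine ⟨((∑ j, |v j|)⁻¹ • v, 0), ⟨smul_mem_polarCone hv hpos.le,
      zero_mem_polarCone K, ?_⟩, ?_⟩
    · simpa using sum_abs_inv_smul hv0
    · dsimp only
      rw [dotp_zero_left, add_zero, dotp_smul_left, ← neg_sub, dotp_neg_right]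
      exact mul_nonneg hpos.le (neg_nonneg.mpr hvd)
  · obtain ⟨v, hv, hvg⟩ := exists_polarCone_dotp_neg hK (y := -g x) hg
    have hv0 : v ≠ 0 := by
      rintro rfl
      exact hvg.ne (dotp_zero_left _)
    have hpos := inv_pos.mpr (sum_abs_pos hv0)
    refine ⟨(0, (∑ j, |v j|)⁻¹ • v), ⟨zero_mem_polarCone C,
      smul_mem_polarCone hv hpos.le, ?_⟩, ?_⟩
    · simpa using sum_abs_inv_smul hv0
    · dsimp only
      rw [dotp_neg_right] at hvg
      rw [dotp_zero_left, zero_add, dotp_smul_left]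
      exact mul_nonneg hpos.le (by linarith)

/-- The auxiliary function is nonpositive at a feasible reference point. -/
theorem Ffun_self_nonpos {s n m : ℕ} (C : Set (Fin n → ℝ)) {K : Set (Fin m → ℝ)}
    (f : (Fin s → ℝ) → (Fin n → ℝ)) {g : (Fin s → ℝ) → (Fin m → ℝ)} {xbar : Fin s → ℝ}
    (hfeas : g xbar ∈ -K) : Ffun C K f g xbar xbar ≤ 0 := by
  refine Real.sSup_nonpos ?_
  rintro _ ⟨p, ⟨-, hp, -⟩, rfl⟩
  have h := hp _ hfeas
  rw [dotp_neg_right] at h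
  have h0 : dotp p.1 (f xbar - f xbar) = 0 := by simp [dotp]
  dsimp only
  linarith

theorem tendsto_add_smul_nhds {s : ℕ} (x u : Fin s → ℝ) :
    Tendsto (fun p : ℝ × (Fin s → ℝ) => x + p.1 • p.2) ((𝓝[>] (0 : ℝ)) ×ˢ 𝓝 u) (𝓝 x) := by
  have h : Tendsto (fun p : ℝ × (Fin s → ℝ) => x + p.1 • p.2) (𝓝 ((0 : ℝ), u))
      (𝓝 (x + (0 : ℝ) • u)) := by
    apply Continuous.tendsto
    fun_prop
  rw [zero_smul, add_zero, nhds_prod_eq] at h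
  exact h.mono_left (Filter.prod_mono_left _ nhdsWithin_le_nhds)

/-- If `x̄` is a weak local minimizer of (P), then for every direction `u` the
first- and second-order lower Hadamard derivatives of `F` at `x̄` (the latter
taken with the zero linear functional) are nonnegative. -/
theorem stmt_3 {s n m : ℕ}
    (C : Set (Fin n → ℝ)) (K : Set (Fin m → ℝ))
    (hC : IsClosedConvexPointedCone C) (hK : IsClosedConvexPointedCone K)
    (hCint : (interior C).Nonempty)
    (X : Set (Fin s → ℝ)) (hX : IsOpen X)
    (f : (Fin s → ℝ) → (Fin n → ℝ)) (g : (Fin s → ℝ) → (Fin m → ℝ))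
    (xbar : Fin s → ℝ) (hxX : xbar ∈ X) (hxfeas : g xbar ∈ -K)
    (hmin : WeakLocalMin C K X f g xbar) :
    ∀ u : Fin s → ℝ,
      (0 : EReal) ≤ lowerHadamardDeriv (Ffun C K f g xbar) xbar u ∧
      (0 : EReal) ≤ lowerHadamardDeriv2 (Ffun C K f g xbar) xbar 0 u := by
  obtain ⟨N, hN, hNmin⟩ := hmin
  intro u
  have hnonneg : ∀ᶠ x in 𝓝 xbar, 0 ≤ Ffun C K f g xbar x := by
    filter_upwards [hN, hX.mem_nhds hxX] with x hxN hx
    exact Ffun_nonneg hC hK hCint (hNmin x hxN hx)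
  have hmono : ∀ᶠ p : ℝ × (Fin s → ℝ) in (𝓝[>] (0 : ℝ)) ×ˢ 𝓝 u,
      0 ≤ Ffun C K f g xbar (xbar + p.1 • p.2) - Ffun C K f g xbar xbar :=
    ((tendsto_add_smul_nhds xbar u).eventually hnonneg).mono fun p hp =>
      sub_nonneg.mpr ((Ffun_self_nonpos C f hxfeas).trans hp)
  have hpos : ∀ᶠ p : ℝ × (Fin s → ℝ) in (𝓝[>] (0 : ℝ)) ×ˢ 𝓝 u, 0 < p.1 :=
    tendsto_fst.eventually self_mem_nhdsWithin
  constructor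
  · refine le_liminf_of_le (by isBoundedDefault) ?_
    filter_upwards [hmono, hpos] with p hp ht
    exact EReal.coe_nonneg.mpr (div_nonneg hp ht.le)
  · refine le_liminf_of_le (by isBoundedDefault) ?_
    filter_upwards [hmono] with p hp
    refine EReal.coe_nonneg.mpr (div_nonneg ?_ (sq_nonneg _))
    simpa using hp
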